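/- arXiv:2401.06932 — 4 statements merged into one kernel-verified Lean document; each statement's English description precedes it below -/
import Mathlib

section
/- Let G be an alphabet with involution and let L be a Pythagorean language over G. Then morphological equivalence is an equivalence relation on the set of ellipses of L: (i) if α is an ellipse (i.e. β*α ∈ L for some nonempty word β, α nonempty), then α ≅ α (that is, α*α ∈ L); (ii) if α ≅ β then β ≅ α; (iii) if α ≅ β and β ≅ γ then α ≅ γ, for nonempty words α, β, γ. -/
/-- The involution on words induced by an involution `s` on letters:
`(a₁a₂⋯a_g)* = a_g*⋯a₂*a₁*`. -/
def wordStar {G : Type*} (s : G → G) (w : List G) : List G :=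
  (w.map s).reverse

/-- A language is self-adjoint if it is closed under the word involution. -/
def IsSelfAdjointLang {G : Type*} (s : G → G) (L : Set (List G)) : Prop :=
  ∀ w ∈ L, wordStar s w ∈ L

/-- A self-adjoint language `L` is Pythagorean if for all nonempty words `α, β, γ`:
whenever `β*α` and `γ*α` lie in `L`, then `α*α` and `γ*β` lie in `L`. -/
def IsPythagorean {G : Type*} (s : G → G) (L : Set (List G)) : Prop :=
  IsSelfAdjointLang s L ∧
    ∀ α β γ : List G, α ≠ [] → β ≠ [] → γ ≠ [] →
      wordStar s β ++ α ∈ L → wordStar s γ ++ α ∈ L →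
      wordStar s α ++ α ∈ L ∧ wordStar s γ ++ β ∈ L

theorem wordStar_append {G : Type*} (s : G → G) (u v : List G) :
    wordStar s (u ++ v) = wordStar s v ++ wordStar s u := by
  simp [wordStar]

theorem wordStar_wordStar {G : Type*} {s : G → G} (hs : ∀ a, s (s a) = a) (w : List G) :
    wordStar s (wordStar s w) = w := by
  simp [wordStar, Function.comp_def, hs]

theorem IsSelfAdjointLang.wordStar_append_mem_symm {G : Type*} {s : G → G}
    (hs : ∀ a, s (s a) = a) {L : Set (List G)} (hL : IsSelfAdjointLang s L) {u v : List G}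
    (h : wordStar s v ++ u ∈ L) : wordStar s u ++ v ∈ L := by
  simpa only [wordStar_append, wordStar_wordStar hs] using hL _ h

/-- Morphological equivalence (`α ≅ β` iff `β*α ∈ L`) is an equivalence relation on the
set of ellipses of a Pythagorean language. -/
theorem morph_equiv_is_equivalence {G : Type*} (s : G → G) (hs : ∀ a, s (s a) = a)
    (L : Set (List G)) (hL : IsPythagorean s L) :
    (∀ α : List G, α ≠ [] → (∃ β : List G, β ≠ [] ∧ wordStar s β ++ α ∈ L) →
        wordStar s α ++ α ∈ L) ∧
    (∀ α β : List G, α ≠ [] → β ≠ [] →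
        wordStar s β ++ α ∈ L → wordStar s α ++ β ∈ L) ∧
    (∀ α β γ : List G, α ≠ [] → β ≠ [] → γ ≠ [] →
        wordStar s β ++ α ∈ L → wordStar s γ ++ β ∈ L → wordStar s γ ++ α ∈ L) := by
  exact ⟨fun α hα ⟨β, hβ, h⟩ => (hL.2 α β β hα hβ hβ h h).1,
    fun _ _ _ _ h => hL.1.wordStar_append_mem_symm hs h,
    fun α β γ hα hβ hγ h₁ h₂ =>
      (hL.2 β α γ hβ hα hγ (hL.1.wordStar_append_mem_symm hs h₁) h₂).2⟩
end

section
/- Let G be an alphabet with involution and let L be a self-adjoint formal language over G. Then the infinite matrix C = [1_L(β*α)], indexed by nonempty words α, β over G (where 1_L is the indicator function of L), is positive semidefinite — meaning that for every finitely supported function c from nonempty words to ℂ, the sum Σ_{α,β} conj(c(β))·c(α)·1_L(β*α) is a nonnegative real number — if and only if L is Pythagorean. -/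
open Classical in
/-- A symmetric and transitive relation has a positive semidefinite indicator matrix. -/
theorem exists_nonneg_sum_of_symm_trans {V : Type*} (R : V → V → Prop)
    (hsymm : ∀ a b, R a b → R b a) (htrans : ∀ a b c, R a b → R b c → R a c)
    (T : Finset V) (x : V → ℂ) :
    ∃ r : ℝ, 0 ≤ r ∧
      ∑ b ∈ T, ∑ a ∈ T, (starRingEnd ℂ) (x b) * x a * (if R b a then 1 else 0) = (r : ℂ) := by
  let P : Set V → V → Prop := fun k a => R a a ∧ {b | R a b} = k
  let d : Set V → ℂ := fun k => ∑ a ∈ T, if P k a then x a else 0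
  have key : ∀ a b, R b a ↔ R a a ∧ R b b ∧ {v | R b v} = {v | R a v} := by
    intro a b
    constructor
    · intro h
      refine ⟨htrans _ _ _ (hsymm _ _ h) h, htrans _ _ _ h (hsymm _ _ h), ?_⟩
      ext v
      exact ⟨htrans _ _ _ (hsymm _ _ h), htrans _ _ _ h⟩
    · rintro ⟨ha, -, h⟩
      have : a ∈ {v | R a v} := ha
      rwa [← h] at this
  refine ⟨∑ k ∈ T.image (fun a => {b | R a b}), Complex.normSq (d k),
    Finset.sum_nonneg fun k _ => Complex.normSq_nonneg _, ?_⟩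
  push_cast
  simp_rw [Complex.normSq_eq_conj_mul_self, d, map_sum, Finset.sum_mul_sum]
  rw [Finset.sum_comm (s := T.image _)]
  refine Finset.sum_congr rfl fun b hb => ?_
  rw [Finset.sum_comm (s := T.image _)]
  refine Finset.sum_congr rfl fun a ha => ?_
  rw [Finset.sum_eq_single_of_mem {v | R b v}
    (Finset.mem_image_of_mem (fun a => {v | R a v}) hb)]
  · by_cases h : R b a
    · obtain ⟨h1, h2, h3⟩ := (key a b).1 h
      simp [P, h, h1, h2, h3]
    · by_cases h2 : R b b
      · have : ¬ P {v | R b v} a := fun h' => h ((key a b).2 ⟨h'.1, h2, h'.2.symm⟩)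
        simp [h, this]
      · simp [P, h, h2]
  · intro k _ hk
    have : ¬ P k b := fun h => hk h.2.symm
    simp [this]

open Classical in
/-- A symmetric relation with positive semidefinite indicator matrix is reflexive on its field
and transitive. -/
theorem refl_and_trans_of_forall_sum_nonneg {V : Type*} (R : V → V → Prop)
    (hsymm : ∀ a b, R a b → R b a)
    (h : ∀ (T : Finset V) (x : V → ℂ), ∃ r : ℝ, 0 ≤ r ∧
      ∑ b ∈ T, ∑ a ∈ T, (starRingEnd ℂ) (x b) * x a * (if R b a then 1 else 0) = (r : ℂ))
    (a b c : V) (hba : R b a) (hca : R c a) : R a a ∧ R c b := by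
  have hrefl : ∀ a b, R b a → R a a := by
    intro a b hba
    by_contra haa
    have hne : a ≠ b := by rintro rfl; exact haa hba
    obtain ⟨r, hr, e⟩ := h {a, b} (fun v => if v = a then -1 else 1)
    have e' := congrArg Complex.re e
    by_cases hbb : R b b <;>
      simp [Finset.sum_pair hne, hne.symm, haa, hba, hsymm _ _ hba, hbb] at e' <;> linarith
  refine ⟨hrefl a b hba, ?_⟩
  by_contra hcb
  have hbc : ¬ R b c := fun h' => hcb (hsymm _ _ h')
  have haa := hrefl a b hba
  have hbb := hrefl b a (hsymm _ _ hba)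
  have hcc := hrefl c a (hsymm _ _ hca)
  have hab : a ≠ b := by rintro rfl; exact hcb hca
  have hac : a ≠ c := by rintro rfl; exact hcb (hsymm _ _ hba)
  have hbc' : b ≠ c := by rintro rfl; exact hcb hbb
  obtain ⟨r, hr, e⟩ := h {a, b, c} (fun v => if v = a then -1 else 1)
  have e' := congrArg Complex.re e
  simp [Finset.sum_insert, hab, hac, hbc', hab.symm, hac.symm, haa, hbb, hcc, hba, hca,
    hsymm _ _ hba, hsymm _ _ hca, hcb, hbc] at e'
  linarith

theorem wordStar_wordStar_append {G : Type*} (s : G → G) (hs : ∀ a, s (s a) = a)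
    (v w : List G) : wordStar s (wordStar s v ++ w) = wordStar s w ++ v := by
  have : s ∘ s = id := funext hs
  simp [wordStar, this]

/-- For a self-adjoint language `L`, the infinite matrix `C = [1_L(β*α)]`, indexed by
nonempty words `α, β`, is positive semidefinite (for every finitely supported
`c` from nonempty words to `ℂ`, the sum `Σ conj(c β) · c α · 1_L(β*α)` is a
nonnegative real number) if and only if `L` is Pythagorean. -/
theorem verbatim_matrix_posSemidef_iff_pythagorean {G : Type*} (s : G → G)
    (hs : ∀ a, s (s a) = a) (L : Set (List G)) (hsa : IsSelfAdjointLang s L) :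
    (∀ c : {w : List G // w ≠ []} →₀ ℂ, ∃ r : ℝ, 0 ≤ r ∧
        ∑ β ∈ c.support, ∑ α ∈ c.support,
          (starRingEnd ℂ) (c β) * c α *
            Set.indicator L (fun _ => (1 : ℂ)) (wordStar s (β : List G) ++ (α : List G))
          = (r : ℂ)) ↔
      IsPythagorean s L := by
  classical
  let R : {w : List G // w ≠ []} → {w : List G // w ≠ []} → Prop :=
    fun b a => wordStar s (b : List G) ++ (a : List G) ∈ L
  have hsymm : ∀ a b, R a b → R b a := fun a b h => by
    have := hsa _ h
    rwa [wordStar_wordStar_append s hs] at this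
  have hind : ∀ a b : {w : List G // w ≠ []},
      Set.indicator L (fun _ => (1 : ℂ)) (wordStar s (b : List G) ++ (a : List G)) =
        if R b a then 1 else 0 := fun a b => Set.indicator_apply _ _ _
  simp_rw [hind]
  constructor
  · intro h
    refine ⟨hsa, fun α β γ hα hβ hγ hβα hγα => ?_⟩
    refine refl_and_trans_of_forall_sum_nonneg R hsymm (fun T x => ?_)
      ⟨α, hα⟩ ⟨β, hβ⟩ ⟨γ, hγ⟩ hβα hγα
    let c : {w : List G // w ≠ []} →₀ ℂ :=
      Finsupp.onFinset T (fun v => if v ∈ T then x v else 0) fun v hv => by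
        by_contra hvT
        simp [hvT] at hv
    have hc : ∀ v ∈ T, c v = x v := fun v hv => by simp [c, hv]
    have hsub : c.support ⊆ T := Finsupp.support_onFinset_subset
    obtain ⟨r, hr, e⟩ := h c
    refine ⟨r, hr, e ▸ ?_⟩
    symm
    rw [Finset.sum_subset hsub fun b _ hb => by simp [Finsupp.notMem_support_iff.1 hb]]
    refine Finset.sum_congr rfl fun b hb => ?_
    rw [Finset.sum_subset hsub fun a _ ha => by simp [Finsupp.notMem_support_iff.1 ha]]
    refine Finset.sum_congr rfl fun a ha => ?_
    rw [hc a ha, hc b hb]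
  · rintro ⟨-, h⟩ c
    refine exists_nonneg_sum_of_symm_trans R hsymm (fun a b d hab hbd => ?_) c.support c
    exact (h b d a b.2 d.2 a.2 (hsymm _ _ hbd) hab).2
end

section
/- For every square complex matrix Z and every n ≥ 1, the matrix p_n(Z, Zᴴ) — the sum over all irreducible Dyck words of length 2n of the corresponding products in Z and Zᴴ — is Hermitian and positive semidefinite. -/
open Matrix ComplexOrder

/-- The height of a word over `{u, d}` (with `u = true`, `d = false`):
`u` counts `+1`, `d` counts `-1`. -/
def ht (w : List Bool) : ℤ :=
  (w.map (fun b => if b then (1 : ℤ) else -1)).sum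

/-- Irreducible Dyck words: nonempty words of total height `0` all of whose proper
nonempty prefixes have height `≥ 1`. -/
def IsIrrDyck (w : List Bool) : Prop :=
  w ≠ [] ∧ ht w = 0 ∧ ∀ p : List Bool, p <+: w → p ≠ [] → p ≠ w → 1 ≤ ht p

/-- `pMat Z n = p_n(Z, Zᴴ)`: the sum over all irreducible Dyck words of length `2n`
of the corresponding products, where `u ↦ Z`, `d ↦ Zᴴ`. -/
noncomputable def pMat {d : ℕ} (Z : Matrix (Fin d) (Fin d) ℂ) (n : ℕ) :
    Matrix (Fin d) (Fin d) ℂ :=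
  ∑ w : Fin (2 * n) → Bool,
    Set.indicator {v | IsIrrDyck v}
      (fun v => (v.map (fun b => if b then Z else Zᴴ)).prod) (List.ofFn w)

/-- Reverse a word and exchange the letters `u` and `d`. -/
def revCompl (w : List Bool) : List Bool := (w.map not).reverse

/-- All nonempty prefixes of the word have height at least `1`. -/
def IsPosPath (w : List Bool) : Prop := ∀ p : List Bool, p <+: w → p ≠ [] → 1 ≤ ht p

theorem ht_append (a b : List Bool) : ht (a ++ b) = ht a + ht b := by
  simp [ht]

theorem revCompl_append (a b : List Bool) :
    revCompl (a ++ b) = revCompl b ++ revCompl a := by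
  simp [revCompl]

theorem revCompl_revCompl (a : List Bool) : revCompl (revCompl a) = a := by
  simp [revCompl, List.map_reverse, Function.comp_def]

theorem length_revCompl (a : List Bool) : (revCompl a).length = a.length := by
  simp [revCompl]

theorem ht_revCompl (a : List Bool) : ht (revCompl a) = -ht a := by
  induction a with
  | nil => rfl
  | cons b l ih =>
    have h := revCompl_append [b] l
    rw [List.singleton_append] at h
    have h' := ht_append [b] l
    rw [List.singleton_append] at h'
    rw [h, ht_append, ih, h']
    cases b <;> simp [revCompl, ht, add_comm]

theorem isIrrDyck_append_revCompl {a c : List Bool} (hlen : a.length = c.length)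
    (hpos : 1 ≤ a.length) :
    IsIrrDyck (a ++ revCompl c) ↔ (IsPosPath a ∧ IsPosPath c) ∧ ht a = ht c := by
  have hc := length_revCompl c
  constructor
  · rintro ⟨-, h0, hp⟩
    rw [ht_append, ht_revCompl] at h0
    refine ⟨⟨fun p hpa hne => hp p (hpa.trans (List.prefix_append _ _)) hne ?_, ?_⟩, by lia⟩
    · rintro rfl
      have := hpa.length_le
      rw [List.length_append] at this
      lia
    · rintro q ⟨r, rfl⟩ hq
      have hq' : 0 < q.length := List.length_pos_iff.2 hq
      have h := hp (a ++ revCompl r)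
        ⟨revCompl q, by rw [revCompl_append, List.append_assoc]⟩ ?_ ?_
      · rw [ht_append, ht_revCompl] at h
        rw [ht_append] at h0
        lia
      · intro h
        have := congrArg List.length h
        simp only [List.length_append, List.length_nil] at this
        lia
      · intro h
        have := congrArg List.length h
        simp only [List.length_append, length_revCompl] at this
        lia
  · rintro ⟨⟨ha, hcp⟩, hh⟩
    refine ⟨?_, by rw [ht_append, ht_revCompl]; lia, fun p hp hne hnw => ?_⟩
    · intro h
      have := congrArg List.length h
      simp only [List.length_append, List.length_nil] at this
      lia
    · obtain ⟨t, ht'⟩ := hp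
      rcases List.append_eq_append_iff.1 ht' with ⟨s, hs, -⟩ | ⟨s, rfl, hst⟩
      · exact ha p ⟨s, hs.symm⟩ hne
      · have hce : c = revCompl t ++ revCompl s := by
          rw [← revCompl_append, ← hst, revCompl_revCompl]
        have h := hcp (revCompl t) ⟨revCompl s, hce.symm⟩ ?_
        · rw [hce, ht_append, ht_revCompl s] at hh
          rw [ht_append]
          lia
        · intro h
          apply hnw
          have := congrArg List.length h
          rw [length_revCompl, List.length_nil, List.length_eq_zero_iff] at this
          rw [hst, this, List.append_nil]

/-- The product of matrices given by a word, where `u ↦ Z` and `d ↦ Zᴴ`. -/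
def wordProd {d : ℕ} (Z : Matrix (Fin d) (Fin d) ℂ) (w : List Bool) :
    Matrix (Fin d) (Fin d) ℂ :=
  (w.map (fun b => if b then Z else Zᴴ)).prod

theorem wordProd_append {d : ℕ} (Z : Matrix (Fin d) (Fin d) ℂ) (a b : List Bool) :
    wordProd Z (a ++ b) = wordProd Z a * wordProd Z b := by
  simp [wordProd]

theorem wordProd_revCompl {d : ℕ} (Z : Matrix (Fin d) (Fin d) ℂ) (a : List Bool) :
    wordProd Z (revCompl a) = (wordProd Z a)ᴴ := by
  induction a with
  | nil => simp [wordProd, revCompl]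
  | cons b l ih =>
    have h := revCompl_append [b] l
    have h' := wordProd_append Z [b] l
    rw [List.singleton_append] at h h'
    rw [h, wordProd_append, ih, h', conjTranspose_mul]
    cases b <;> simp [revCompl, wordProd]

theorem sum_ofFn_two_mul {M : Type*} [AddCommMonoid M] (n : ℕ) (F : List Bool → M) :
    ∑ w : Fin (2 * n) → Bool, F (List.ofFn w) =
      ∑ a : Fin n → Bool, ∑ c : Fin n → Bool,
        F (List.ofFn a ++ revCompl (List.ofFn c)) := by
  rw [two_mul, ← (Fin.appendEquiv n n).sum_comp, Fintype.sum_prod_type]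
  refine Finset.sum_congr rfl fun a _ => ?_
  have hinv : Function.Involutive fun (c : Fin n → Bool) (i : Fin n) => !c i.rev :=
    fun c => by simp
  rw [← Equiv.sum_comp (hinv.toPerm _)]
  refine Finset.sum_congr rfl fun c _ => ?_
  simp only [Fin.appendEquiv, Equiv.coe_fn_mk, List.ofFn_fin_append]
  congr 2
  apply List.ext_getElem <;> simp [revCompl, Fin.rev]
  intro i _
  congr 2
  lia

open Classical in
/-- The sum of the products over all positive paths of length `n` ending at height `h`. -/
noncomputable def posPathSum {d : ℕ} (Z : Matrix (Fin d) (Fin d) ℂ) (n : ℕ) (h : ℤ) :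
    Matrix (Fin d) (Fin d) ℂ :=
  ∑ a : Fin n → Bool,
    if IsPosPath (List.ofFn a) ∧ ht (List.ofFn a) = h then wordProd Z (List.ofFn a) else 0

theorem pMat_eq_sum_posPathSum {d : ℕ} (Z : Matrix (Fin d) (Fin d) ℂ) {n : ℕ} (hn : 1 ≤ n) :
    pMat Z n = ∑ h ∈ Finset.univ.image (fun a : Fin n → Bool => ht (List.ofFn a)),
      posPathSum Z n h * (posPathSum Z n h)ᴴ := by
  classical
  simp only [pMat, posPathSum, conjTranspose_sum, Finset.sum_mul_sum]
  rw [sum_ofFn_two_mul n (Set.indicator {v | IsIrrDyck v} _),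
    Finset.sum_comm (s := Finset.univ.image _)]
  refine Finset.sum_congr rfl fun a _ => ?_
  rw [Finset.sum_comm]
  refine Finset.sum_congr rfl fun c _ => ?_
  rw [Finset.sum_eq_single_of_mem (ht (List.ofFn a))
    (Finset.mem_image.2 ⟨a, Finset.mem_univ a, rfl⟩)]
  · have hiff := isIrrDyck_append_revCompl (a := List.ofFn a) (c := List.ofFn c)
      (by simp) (by simpa using hn)
    have hprod := wordProd_append Z (List.ofFn a) (revCompl (List.ofFn c))
    rw [wordProd_revCompl] at hprod
    simp only [Set.indicator_apply, Set.mem_ofPred_eq, hiff]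
    change (if _ then wordProd Z _ else 0) = _
    rw [hprod]
    by_cases h1 : IsPosPath (List.ofFn a) <;> by_cases h2 : IsPosPath (List.ofFn c) <;>
      by_cases h3 : ht (List.ofFn a) = ht (List.ofFn c) <;> simp [h1, h2, h3, eq_comm]
  · intro h _ hne
    rw [if_neg fun hh => hne hh.2.symm, zero_mul]

/-- For every square complex matrix `Z` and `n ≥ 1`, `p_n(Z, Zᴴ)` is Hermitian and
positive semidefinite. -/
theorem pMat_posSemidef {d : ℕ} (Z : Matrix (Fin d) (Fin d) ℂ) (n : ℕ) (hn : 1 ≤ n) :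
    (pMat Z n).IsHermitian ∧ (pMat Z n).PosSemidef := by
  have h : (pMat Z n).PosSemidef := by
    rw [pMat_eq_sum_posPathSum Z hn]
    exact posSemidef_sum _ fun h _ => posSemidef_self_mul_conjTranspose _
  exact ⟨h.isHermitian, h⟩
end

section
/- (Anderson–Morley–Trapp, two-by-two case) Let X and Z be n×n complex matrices with X Hermitian, and suppose there exists a Hermitian matrix Y₀ such that the block matrix [[1 − Y₀ − X, Z], [Zᴴ, Y₀]] is positive semidefinite. Then the set S of Hermitian matrices Y for which [[1 − Y − X, Z], [Zᴴ, Y]] is positive semidefinite has a maximum in the Löwner order: there exists Ŷ ∈ S such that every Y ∈ S satisfies Y ⪯ Ŷ. -/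
open Matrix ComplexOrder

section BlockMax

open Filter Topology
open scoped MatrixOrder Matrix.Norms.L2Operator

variable {ι κ : Type*} [Fintype ι] [DecidableEq ι] [Fintype κ] [DecidableEq κ]

theorem Matrix.isClosed_posSemidef : IsClosed {M : Matrix ι ι ℂ | M.PosSemidef} := by
  simpa only [nonneg_iff_posSemidef] using
    CStarAlgebra.isClosed_nonneg (A := Matrix ι ι ℂ)

theorem Matrix.PosSemidef.of_tendsto {M : ℕ → Matrix ι ι ℂ} {L : Matrix ι ι ℂ}
    (hL : Tendsto M atTop (𝓝 L)) (hM : ∀ k, (M k).PosSemidef) : L.PosSemidef :=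
  Matrix.isClosed_posSemidef.mem_of_tendsto hL (Eventually.of_forall hM)

theorem Matrix.exists_subseq_tendsto_of_posSemidef {A : Matrix ι ι ℂ} {Y : ℕ → Matrix ι ι ℂ}
    (h0 : ∀ k, (Y k).PosSemidef) (hA : ∀ k, (A - Y k).PosSemidef) :
    ∃ L, ∃ φ : ℕ → ℕ, StrictMono φ ∧ Tendsto (Y ∘ φ) atTop (𝓝 L) := by
  have : ProperSpace (Matrix ι ι ℂ) := FiniteDimensional.proper ℂ _
  have hmem : ∀ k, Y k ∈ Metric.closedBall (0 : Matrix ι ι ℂ) ‖A‖ := fun k => by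
    rw [mem_closedBall_zero_iff]
    exact CStarAlgebra.norm_le_norm_of_nonneg_of_le (h0 k).nonneg (le_iff.mpr (hA k))
  obtain ⟨L, -, φ, hφ, hL⟩ := tendsto_subseq_of_bounded Metric.isBounded_closedBall hmem
  exact ⟨L, φ, hφ, hL⟩

omit [DecidableEq ι] [DecidableEq κ] in
theorem Matrix.PosSemidef.fromBlocks_diagonal {E : Matrix ι ι ℂ} {F : Matrix κ κ ℂ}
    (hE : E.PosSemidef) (hF : F.PosSemidef) : (fromBlocks E 0 0 F).PosSemidef := by
  refine .of_dotProduct_mulVec_nonneg (hE.1.fromBlocks (by simp) hF.1) fun x => ?_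
  rw [← Sum.elim_comp_inl_inr x, fromBlocks_mulVec, Function.star_sumElim]
  simpa using add_nonneg (hE.dotProduct_mulVec_nonneg _) (hF.dotProduct_mulVec_nonneg _)

omit [DecidableEq ι] [DecidableEq κ] in
theorem Matrix.PosSemidef.fromBlocks_mono {A A' : Matrix ι ι ℂ} {D D' : Matrix κ κ ℂ}
    {B : Matrix ι κ ℂ} {C : Matrix κ ι ℂ} (h : (fromBlocks A B C D).PosSemidef)
    (hA : (A' - A).PosSemidef) (hD : (D' - D).PosSemidef) :
    (fromBlocks A' B C D').PosSemidef := by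
  simpa [fromBlocks_add] using h.add (hA.fromBlocks_diagonal hD)

omit [DecidableEq ι] in
theorem Matrix.PosSemidef.fromBlocks_iff_schur (A : Matrix ι ι ℂ) (B : Matrix ι κ ℂ)
    {D : Matrix κ κ ℂ} (hD : D.PosDef) :
    (fromBlocks A B Bᴴ D).PosSemidef ↔ (A - B * D⁻¹ * Bᴴ).PosSemidef :=
  have := hD.isUnit.invertible
  hD.fromBlocks₂₂ A B

/-- A regularized Schur complement iteration, decreasing to the largest `Y` such that
`[[A - Y, Z], [Zᴴ, Y]]` is positive semidefinite. -/
noncomputable def regularizedSchurIter (A Z : Matrix ι ι ℂ) : ℕ → Matrix ι ι ℂ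
  | 0 => A
  | k + 1 =>
    A - Z * (regularizedSchurIter A Z k + (1 / ((k : ℝ) + 1)) • (1 : Matrix ι ι ℂ))⁻¹ * Zᴴ

omit [Fintype ι] in
theorem Matrix.PosSemidef.add_smul_one_posDef {M : Matrix ι ι ℂ} (hM : M.PosSemidef) (k : ℕ) :
    (M + (1 / ((k : ℝ) + 1)) • (1 : Matrix ι ι ℂ)).PosDef :=
  (PosDef.one.smul (by positivity)).posSemidef_add hM

theorem regularizedSchurIter_succ_ge {A Z Y D : Matrix ι ι ℂ} {k : ℕ}
    (hk : (regularizedSchurIter A Z k).PosSemidef)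
    (h : (fromBlocks (A - Y) Z Zᴴ D).PosSemidef)
    (hD : (regularizedSchurIter A Z k + (1 / ((k : ℝ) + 1)) • (1 : Matrix ι ι ℂ) - D).PosSemidef) :
    (regularizedSchurIter A Z (k + 1) - Y).PosSemidef := by
  have := (PosSemidef.fromBlocks_iff_schur _ _ (hk.add_smul_one_posDef k)).mp
    (h.fromBlocks_mono (A' := A - Y) (by simpa using PosSemidef.zero) hD)
  rwa [sub_right_comm] at this

theorem regularizedSchurIter_block {A Z : Matrix ι ι ℂ} {k : ℕ}
    (hk : (regularizedSchurIter A Z k).PosSemidef) :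
    (fromBlocks (A - regularizedSchurIter A Z (k + 1)) Z Zᴴ
      (regularizedSchurIter A Z k + (1 / ((k : ℝ) + 1)) • (1 : Matrix ι ι ℂ))).PosSemidef := by
  rw [PosSemidef.fromBlocks_iff_schur _ _ (hk.add_smul_one_posDef k)]
  simpa [regularizedSchurIter] using PosSemidef.zero

omit [Fintype ι] [DecidableEq ι] [Fintype κ] [DecidableEq κ] in
theorem Matrix.PosSemidef.diagonal_of_fromBlocks {A : Matrix ι ι ℂ} {B : Matrix ι κ ℂ}
    {C : Matrix κ ι ℂ} {D : Matrix κ κ ℂ} (h : (fromBlocks A B C D).PosSemidef) :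
    A.PosSemidef ∧ D.PosSemidef :=
  ⟨h.submatrix Sum.inl, h.submatrix Sum.inr⟩

theorem regularizedSchurIter_ge {A Z Y : Matrix ι ι ℂ}
    (h : (fromBlocks (A - Y) Z Zᴴ Y).PosSemidef) (k : ℕ) :
    (regularizedSchurIter A Z k - Y).PosSemidef := by
  induction k with
  | zero => exact h.diagonal_of_fromBlocks.1
  | succ k ih =>
    have hk : (regularizedSchurIter A Z k).PosSemidef := by
      simpa using ih.add h.diagonal_of_fromBlocks.2
    refine regularizedSchurIter_succ_ge hk h ?_
    rw [add_sub_right_comm]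
    exact ih.add (PosSemidef.one.smul (by positivity))

theorem regularizedSchurIter_antitone {A Z : Matrix ι ι ℂ}
    (hk : ∀ k, (regularizedSchurIter A Z k).PosSemidef) :
    Antitone (regularizedSchurIter A Z) := by
  refine antitone_nat_of_succ_le fun k => le_iff.mpr ?_
  induction k with
  | zero => exact (regularizedSchurIter_block (hk 0)).diagonal_of_fromBlocks.1
  | succ k ih =>
    refine regularizedSchurIter_succ_ge (hk k) (regularizedSchurIter_block (hk (k + 1))) ?_
    rw [add_sub_add_comm, ← sub_smul]
    refine ih.add (PosSemidef.one.smul (sub_nonneg.mpr ?_))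
    exact one_div_le_one_div_of_le (by positivity) (by push_cast; linarith)

/-- The matrices `Y` with `[[A - Y, Z], [Zᴴ, Y]]` positive semidefinite have a maximum in the
Löwner order as soon as there is one. -/
theorem exists_max_fromBlocks_posSemidef {A Z Y₀ : Matrix ι ι ℂ}
    (h0 : (fromBlocks (A - Y₀) Z Zᴴ Y₀).PosSemidef) :
    ∃ L : Matrix ι ι ℂ, (fromBlocks (A - L) Z Zᴴ L).PosSemidef ∧
      ∀ Y, (fromBlocks (A - Y) Z Zᴴ Y).PosSemidef → (L - Y).PosSemidef := by
  have hpos : ∀ k, (regularizedSchurIter A Z k).PosSemidef := fun k => by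
    simpa using (regularizedSchurIter_ge h0 k).add h0.diagonal_of_fromBlocks.2
  have hanti := regularizedSchurIter_antitone hpos
  obtain ⟨L, φ, hφ, hL⟩ := exists_subseq_tendsto_of_posSemidef hpos
    fun k => le_iff.mp (hanti (Nat.zero_le k))
  have hle : ∀ k, (regularizedSchurIter A Z k - L).PosSemidef := fun k =>
    le_iff.mp <| le_of_tendsto hL <| (eventually_ge_atTop k).mono fun j hj =>
      hanti (hj.trans (hφ.id_le j))
  refine ⟨L, ?_, fun Y hY => .of_tendsto (hL.sub_const Y) fun j => regularizedSchurIter_ge hY _⟩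
  have hblock : ∀ k, (fromBlocks (A - L) Z Zᴴ
      (regularizedSchurIter A Z k + (1 / ((k : ℝ) + 1)) • (1 : Matrix ι ι ℂ))).PosSemidef :=
    fun k => (regularizedSchurIter_block (hpos k)).fromBlocks_mono
      (by simpa using hle (k + 1)) (by simpa using PosSemidef.zero)
  have hlim : Tendsto (fun j => regularizedSchurIter A Z (φ j) +
      (1 / ((φ j : ℝ) + 1)) • (1 : Matrix ι ι ℂ)) atTop (𝓝 L) := by
    simpa using hL.add
      (((tendsto_one_div_add_atTop_nhds_zero_nat (𝕜 := ℝ)).comp hφ.tendsto_atTop).smul_const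
        (1 : Matrix ι ι ℂ))
  have hcont : Continuous fun D : Matrix ι ι ℂ => fromBlocks (A - L) Z Zᴴ D :=
    continuous_const.matrix_fromBlocks continuous_const continuous_const continuous_id
  exact .of_tendsto ((hcont.tendsto L).comp hlim) fun j => hblock (φ j)

end BlockMax

/-- **Anderson–Morley–Trapp (two-by-two case).** If `X` is Hermitian and some
Hermitian `Y₀` makes `[[1 - Y₀ - X, Z], [Zᴴ, Y₀]]` positive semidefinite, then the
set of Hermitian `Y` with `[[1 - Y - X, Z], [Zᴴ, Y]]` positive semidefinite has a
maximum element in the Löwner order. -/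
theorem amt_max_Y {n : ℕ} (X Z : Matrix (Fin n) (Fin n) ℂ) (hX : X.IsHermitian)
    (Y₀ : Matrix (Fin n) (Fin n) ℂ) (hY₀ : Y₀.IsHermitian)
    (h0 : (Matrix.fromBlocks (1 - Y₀ - X) Z Zᴴ Y₀).PosSemidef) :
    ∃ Yhat : Matrix (Fin n) (Fin n) ℂ, Yhat.IsHermitian ∧
      (Matrix.fromBlocks (1 - Yhat - X) Z Zᴴ Yhat).PosSemidef ∧
      ∀ Y : Matrix (Fin n) (Fin n) ℂ, Y.IsHermitian →
        (Matrix.fromBlocks (1 - Y - X) Z Zᴴ Y).PosSemidef → (Yhat - Y).PosSemidef := by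
  simp only [sub_right_comm (1 : Matrix (Fin n) (Fin n) ℂ) _ X] at h0 ⊢
  obtain ⟨L, hL, hmax⟩ := exists_max_fromBlocks_posSemidef h0
  exact ⟨L, hL.diagonal_of_fromBlocks.2.isHermitian, hL, fun Y _ hY => hmax Y hY⟩
end
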